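/- arXiv:1805.10739 — 4 statements merged into one kernel-verified Lean document; each statement's English description precedes it below -/
import Mathlib

section
/- If b ≥ 2 is even, then the multiplicity of b-ARH numbers is unbounded: for every natural number n there exists a b-ARH number N whose set of additive multipliers has cardinality greater than n. -/
/-- The list `0^i 1^m 0^m 1^i` of base-`b` digits, least significant digit first. Adding the
number with these digits to its reversal gives the repunit with `2 * (i + m)` digits. -/
def zeroOneBlocks (i m : ℕ) : List ℕ :=
  List.replicate i 0 ++ List.replicate m 1 ++ List.replicate m 0 ++ List.replicate i 1

lemma digits_ofDigits_zeroOneBlocks {b i : ℕ} (hb : 2 ≤ b) (hi : 0 < i) (m : ℕ) :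
    Nat.digits b (Nat.ofDigits b (zeroOneBlocks i m)) = zeroOneBlocks i m := by
  apply Nat.digits_ofDigits b (by omega)
  · intro d hd
    simp only [zeroOneBlocks, List.mem_append, List.mem_replicate] at hd
    omega
  · intro h
    simp [zeroOneBlocks, hi.ne']

lemma digits_ofDigits_replicate_one {b : ℕ} (hb : 2 ≤ b) (m : ℕ) :
    Nat.digits b (Nat.ofDigits b (List.replicate m 1)) = List.replicate m 1 := by
  apply Nat.digits_ofDigits b (by omega)
  · intro d hd
    rw [List.eq_of_mem_replicate hd]
    omega
  · intro h
    simp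

lemma ofDigits_zeroOneBlocks (b i m : ℕ) :
    Nat.ofDigits b (zeroOneBlocks i m) =
      b ^ i * (Nat.ofDigits b (List.replicate m 1) +
        b ^ (m + m) * Nat.ofDigits b (List.replicate i 1)) := by
  simp only [zeroOneBlocks, Nat.ofDigits_append, Nat.ofDigits_replicate_zero, List.length_append,
    List.length_replicate]
  ring

lemma ofDigits_zeroOneBlocks_add_reverse (b i m : ℕ) :
    Nat.ofDigits b (zeroOneBlocks i m) + Nat.ofDigits b (zeroOneBlocks i m).reverse =
      Nat.ofDigits b (List.replicate (2 * (i + m)) 1) := by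
  have h : 2 * (i + m) = i + m + m + i := by ring
  rw [h]
  simp only [zeroOneBlocks, List.reverse_append, List.reverse_replicate, List.replicate_add,
    Nat.ofDigits_append, Nat.ofDigits_replicate_zero, List.length_append, List.length_replicate]
  ring

lemma not_pow_succ_dvd_ofDigits_zeroOneBlocks {b m : ℕ} (hb : 2 ≤ b) (hm : 0 < m) (i : ℕ) :
    ¬ b ^ (i + 1) ∣ Nat.ofDigits b (zeroOneBlocks i m) := by
  obtain ⟨m, rfl⟩ := Nat.exists_eq_succ_of_ne_zero hm.ne'
  rw [ofDigits_zeroOneBlocks, pow_succ, Nat.mul_dvd_mul_iff_left (by positivity)]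
  intro h
  have h1 : b ∣ b ^ (m.succ + m.succ) * Nat.ofDigits b (List.replicate i 1) :=
    (dvd_pow_self b (by omega)).mul_right _
  rw [← Nat.dvd_add_iff_left h1, List.replicate_succ, Nat.ofDigits_cons,
    ← Nat.dvd_add_iff_left (dvd_mul_right b _)] at h
  have := Nat.le_of_dvd one_pos h
  omega

lemma ofDigits_zeroOneBlocks_injOn {b : ℕ} (hb : 2 ≤ b) (k : ℕ) :
    Set.InjOn (fun i => Nat.ofDigits b (zeroOneBlocks i (k - i))) (Set.Iio k) := by
  have ne_of_lt {i j : ℕ} (hij : i < j) (hj : j < k) :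
      Nat.ofDigits b (zeroOneBlocks i (k - i)) ≠ Nat.ofDigits b (zeroOneBlocks j (k - j)) := by
    intro h
    apply not_pow_succ_dvd_ofDigits_zeroOneBlocks hb (by omega : 0 < k - i) i
    rw [h, ofDigits_zeroOneBlocks]
    exact (pow_dvd_pow b hij).mul_right _
  intro i hi j hj h
  rcases lt_trichotomy i j with hij | hij | hij
  · exact absurd h (ne_of_lt hij hj)
  · exact hij
  · exact absurd h.symm (ne_of_lt hij hi)

/-- If `b ≥ 2` is even, the multiplicity of `b`-ARH numbers is unbounded: for
every natural number `n` there exists a positive integer `N` whose set of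
additive multipliers has cardinality greater than `n` (in particular `N` is a
`b`-ARH number). -/
theorem stmt_7 (b : ℕ) (hb : 2 ≤ b) (hbe : Even b) (n : ℕ) :
    ∃ N : ℕ, 0 < N ∧ ∃ S : Finset ℕ, n < S.card ∧
      ∀ M ∈ S, 0 < M ∧
        N = M * (Nat.digits b N).sum +
          Nat.ofDigits b (Nat.digits b (M * (Nat.digits b N).sum)).reverse := by
  set k := b ^ (n + 2) with hk
  have hk_large : 2 * n + 3 < k := by
    have h1 : 2 ^ (n + 2) ≤ k := Nat.pow_le_pow_left hb _
    have h2 : n < 2 ^ n := Nat.lt_two_pow_self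
    rw [pow_add] at h1
    omega
  have hsum : (Nat.digits b (Nat.ofDigits b (List.replicate (2 * k) 1))).sum = 2 * k := by
    simp [digits_ofDigits_replicate_one hb]
  have hdvd {i : ℕ} (hi : n + 3 ≤ i) :
      2 * k ∣ Nat.ofDigits b (zeroOneBlocks i (k - i)) := by
    rw [ofDigits_zeroOneBlocks]
    refine Dvd.dvd.mul_right (dvd_trans ?_ (pow_dvd_pow b hi)) _
    rw [pow_succ', hk]
    exact mul_dvd_mul_right hbe.two_dvd _
  have hpos {i : ℕ} (hi : i < k) : 0 < Nat.ofDigits b (zeroOneBlocks i (k - i)) := by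
    refine Nat.pos_of_ne_zero fun h => ?_
    apply not_pow_succ_dvd_ofDigits_zeroOneBlocks hb (by omega : 0 < k - i) i
    simp [h]
  refine ⟨Nat.ofDigits b (List.replicate (2 * k) 1), ?_,
    (Finset.Ico (n + 3) k).image
      fun i => Nat.ofDigits b (zeroOneBlocks i (k - i)) / (2 * k), ?_, ?_⟩
  · refine Nat.pos_of_ne_zero fun h => ?_
    simp only [h, Nat.digits_zero, List.sum_nil] at hsum
    omega
  · rw [Finset.card_image_of_injOn, Nat.card_Ico]
    · omega
    · intro i hi j hj h
      simp only [Finset.coe_Ico, Set.mem_Ico] at hi hj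
      exact ofDigits_zeroOneBlocks_injOn hb k hi.2 hj.2
        ((Nat.div_left_inj (hdvd hi.1) (hdvd hj.1)).1 h)
  · intro M hM
    obtain ⟨i, hi, rfl⟩ := Finset.mem_image.1 hM
    rw [Finset.mem_Ico] at hi
    rw [hsum, Nat.div_mul_cancel (hdvd hi.1), digits_ofDigits_zeroOneBlocks hb (by omega),
      ofDigits_zeroOneBlocks_add_reverse, Nat.add_sub_cancel' hi.2.le]
    exact ⟨Nat.div_pos (Nat.le_of_dvd (hpos hi.2) (hdvd hi.1)) (by omega), rfl⟩
end

section
/- If b ≥ 3 is odd, then there exist infinitely many b-MRH numbers that are perfect squares; i.e., the set of positive integers N such that N is a perfect square and N is a b-MRH number is infinite. -/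
theorem ofDigits_replicate_pred (b n : ℕ) (hb : 1 ≤ b) :
    Nat.ofDigits b (List.replicate n (b - 1)) + 1 = b ^ n := by
  obtain ⟨c, rfl⟩ := Nat.exists_eq_add_of_le' hb
  induction n with
  | zero => simp
  | succ n ih =>
    rw [List.replicate_succ, Nat.ofDigits_cons, pow_succ, ← ih]
    simp only [Nat.add_sub_cancel]
    ring

theorem ofDigits_replicate_zero (b n : ℕ) :
    Nat.ofDigits b (List.replicate n 0) = 0 := by
  induction n with
  | zero => simp
  | succ n ih => rw [List.replicate_succ, Nat.ofDigits_cons, ih]; simp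

theorem digits_pow_sub_one (b n : ℕ) (hb : 2 ≤ b) :
    Nat.digits b (b ^ n - 1) = List.replicate n (b - 1) := by
  rw [← ofDigits_replicate_pred b n (by omega), Nat.add_sub_cancel]
  refine Nat.digits_ofDigits b (by omega) _ (fun l hl => ?_) (fun h => ?_)
  · have := List.eq_of_mem_replicate hl
    omega
  · rw [List.getLast_replicate]
    omega

theorem sum_digits_pow_sub_one_sq (b m : ℕ) (hb : 3 ≤ b) :
    (Nat.digits b ((b ^ (m + 1) - 1) ^ 2)).sum = (m + 1) * (b - 1) := by
  have hpow := ofDigits_replicate_pred b m (by omega)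
  set L : List ℕ := (1 :: List.replicate m 0) ++ ((b - 2) :: List.replicate m (b - 1)) with hL
  have hval : Nat.ofDigits b L = (b ^ (m + 1) - 1) ^ 2 := by
    rw [hL, Nat.ofDigits_append, Nat.ofDigits_cons, Nat.ofDigits_cons, ofDigits_replicate_zero]
    simp only [List.length_cons, List.length_replicate]
    generalize Nat.ofDigits b (List.replicate m (b - 1)) = x at hpow
    obtain ⟨c, rfl⟩ := Nat.exists_eq_add_of_le' (show 2 ≤ b by omega)
    rw [pow_succ, ← hpow]
    have h : (x + 1) * (c + 2) - 1 = x * (c + 2) + c + 1 := by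
      have : (x + 1) * (c + 2) = x * (c + 2) + c + 2 := by ring
      omega
    rw [h]
    simp only [Nat.add_sub_cancel]
    ring
  rw [← hval, Nat.digits_ofDigits b (by omega) L (fun l hl => ?_) (fun h => ?_)]
  · obtain ⟨c, rfl⟩ := Nat.exists_eq_add_of_le' (show 2 ≤ b by omega)
    simp only [hL, List.sum_append, List.sum_cons, List.sum_replicate, smul_eq_mul,
      Nat.add_sub_cancel, show c + 2 - 1 = c + 1 by omega]
    ring
  · simp only [hL, List.mem_append, List.mem_cons, List.mem_replicate] at hl
    omega
  · have hmem : L.getLast h ∈ (b - 2) :: List.replicate m (b - 1) := by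
      simp only [hL, List.getLast_append_of_ne_nil _ (List.cons_ne_nil _ _)]
      exact List.getLast_mem _
    simp only [List.mem_cons, List.mem_replicate] at hmem
    omega

theorem two_pow_mul_pred_dvd (b k : ℕ) (hbo : Odd b) :
    2 ^ k * (b - 1) ∣ b ^ 2 ^ k - 1 := by
  induction k with
  | zero => simp
  | succ k ih =>
    have h : b ^ 2 ^ (k + 1) - 1 = (b ^ 2 ^ k + 1) * (b ^ 2 ^ k - 1) := by
      rw [pow_succ 2 k, pow_mul]
      simpa using Nat.sq_sub_sq (b ^ 2 ^ k) 1
    rw [h, pow_succ', mul_assoc]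
    exact mul_dvd_mul (hbo.pow.add_odd odd_one).two_dvd ih

/-- If `b ≥ 3` is odd, there exist infinitely many `b`-MRH numbers that are
perfect squares: the set of positive integers `N` such that `N` is a perfect
square and `N` is a `b`-MRH number is infinite. -/
theorem stmt_14 (b : ℕ) (hb : 3 ≤ b) (hbo : Odd b) :
    {N : ℕ | 0 < N ∧ (∃ m : ℕ, N = m ^ 2) ∧ ∃ M : ℕ, 0 < M ∧
      N = M * (Nat.digits b N).sum *
        Nat.ofDigits b (Nat.digits b (M * (Nat.digits b N).sum)).reverse}.Infinite := by
  have hpos (k : ℕ) : 1 < b ^ 2 ^ k := Nat.one_lt_pow (by positivity) (by omega)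
  refine Set.infinite_of_injective_forall_mem (f := fun k : ℕ => (b ^ 2 ^ k - 1) ^ 2) ?_ ?_
  · intro i j hij
    have h := Nat.pow_left_injective (n := 2) (by norm_num) hij
    have hi := hpos i
    have hj := hpos j
    have h' : b ^ 2 ^ i = b ^ 2 ^ j := by omega
    exact Nat.pow_right_injective le_rfl (Nat.pow_right_injective (by omega : 2 ≤ b) h')
  · intro k
    have hA : 0 < b ^ 2 ^ k - 1 := Nat.sub_pos_of_lt (hpos k)
    have hsum : (Nat.digits b ((b ^ 2 ^ k - 1) ^ 2)).sum = 2 ^ k * (b - 1) := by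
      obtain ⟨m, hm⟩ := Nat.exists_eq_add_of_le' (Nat.one_le_two_pow (n := k))
      rw [hm, sum_digits_pow_sub_one_sq b m hb]
    obtain ⟨M, hM⟩ := two_pow_mul_pred_dvd b k hbo
    refine ⟨pow_pos hA 2, ⟨_, rfl⟩, M, ?_, ?_⟩
    · rcases Nat.eq_zero_or_pos M with rfl | h
      · simp [hM] at hA
      · exact h
    · rw [hsum, mul_comm M, ← hM, digits_pow_sub_one b _ (by omega), List.reverse_replicate,
        ← digits_pow_sub_one b _ (by omega), Nat.ofDigits_digits, sq]
end

section
/- Let b ≥ 2 be a base and let N be a positive integer with k base-b digits that is a b-ARH number with additive multiplier M, i.e., N = M·s_b(N) + (M·s_b(N))^R. If either (b ≥ 10 and M ≥ b^6), or (3 ≤ b ≤ 9 and M ≥ b^7), or (b = 2 and M ≥ b^8), then k ≤ 2·⌊log_b M⌋. -/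
theorem sum_digits_le_pred_mul_length {b : ℕ} (hb : 2 ≤ b) (n : ℕ) :
    (Nat.digits b n).sum ≤ (b - 1) * (Nat.digits b n).length := by
  have h := List.sum_le_card_nsmul (Nat.digits b n) (b - 1)
    fun d hd => Nat.le_sub_one_of_lt (Nat.digits_lt_base hb hd)
  rwa [smul_eq_mul, mul_comm] at h

theorem ofDigits_reverse_digits_lt {b : ℕ} (hb : 2 ≤ b) (n : ℕ) :
    Nat.ofDigits b (Nat.digits b n).reverse < b ^ (Nat.digits b n).length := by
  have h := Nat.ofDigits_lt_base_pow_length (b := b) (l := (Nat.digits b n).reverse) hb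
    fun d hd => Nat.digits_lt_base hb (List.mem_reverse.1 hd)
  rwa [List.length_reverse] at h

theorem length_digits_add_reverse_le {b : ℕ} (hb : 2 ≤ b) (n : ℕ) :
    (Nat.digits b (n + Nat.ofDigits b (Nat.digits b n).reverse)).length ≤
      (Nat.digits b n).length + 1 := by
  rw [Nat.digits_length_le_iff hb, pow_succ]
  have h₁ := ofDigits_reverse_digits_lt hb n
  have h₂ := Nat.lt_base_pow_length_digits (b := b) (m := n) hb
  nlinarith

theorem pred_mul_le_pow {b n : ℕ} (hb : 2 ≤ b) (hn : 4 ≤ n) :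
    (b - 1) * (2 * n + 5) ≤ b ^ n := by
  obtain ⟨c, rfl⟩ := Nat.exists_eq_add_of_le' hb
  rw [show c + 2 - 1 = c + 1 from rfl]
  induction n, hn using Nat.le_induction with
  | base => ring_nf; nlinarith [Nat.zero_le (c ^ 2), Nat.zero_le (c ^ 3), Nat.zero_le (c ^ 4)]
  | succ n hn ih =>
    rw [pow_succ]
    nlinarith [Nat.mul_le_mul ih (by omega : 2 ≤ c + 2), Nat.zero_le (c * n)]

theorem pow_length_digits_le_of_eq_add_reverse {b N M : ℕ} (hb : 2 ≤ b) (hN : 0 < N)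
    (hARH : N = M * (Nat.digits b N).sum +
      Nat.ofDigits b (Nat.digits b (M * (Nat.digits b N).sum)).reverse) :
    b ^ (Nat.digits b N).length ≤ b ^ 2 * (M * (Nat.digits b N).sum) := by
  set P := M * (Nat.digits b N).sum with hP
  have hP0 : P ≠ 0 := by
    intro h
    rw [h] at hARH
    simp at hARH
    omega
  have hlen : (Nat.digits b N).length ≤ (Nat.digits b P).length + 1 := by
    conv_lhs => rw [hARH]
    exact length_digits_add_reverse_le hb P
  calc b ^ (Nat.digits b N).length
      ≤ b ^ ((Nat.digits b P).length + 1) := Nat.pow_le_pow_right (by omega) hlen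
    _ = b * b ^ (Nat.digits b P).length := pow_succ' _ _
    _ ≤ b * (b * P) :=
        Nat.mul_le_mul_left _ (Nat.base_pow_length_digits_le b P hb hP0)
    _ = b ^ 2 * P := by ring

/-- Let `b ≥ 2` and let `N` be a positive integer with `k` base-`b` digits that
is a `b`-ARH number with additive multiplier `M`. If either `b ≥ 10` and
`M ≥ b ^ 6`, or `3 ≤ b ≤ 9` and `M ≥ b ^ 7`, or `b = 2` and `M ≥ b ^ 8`, then
`k ≤ 2 * ⌊log_b M⌋`. -/
theorem stmt_17 (b N M k : ℕ) (hb : 2 ≤ b) (hNpos : 0 < N)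
    (hk : k = (Nat.digits b N).length) (hM : 0 < M)
    (hARH : N = M * (Nat.digits b N).sum +
      Nat.ofDigits b (Nat.digits b (M * (Nat.digits b N).sum)).reverse)
    (hcase : (10 ≤ b ∧ b ^ 6 ≤ M) ∨ (3 ≤ b ∧ b ≤ 9 ∧ b ^ 7 ≤ M) ∨
      (b = 2 ∧ b ^ 8 ≤ M)) :
    k ≤ 2 * Nat.log b M := by
  have hL : 6 ≤ Nat.log b M := by
    refine Nat.le_log_of_pow_le hb ?_
    have hmono : ∀ j, 6 ≤ j → b ^ 6 ≤ b ^ j := fun j hj => Nat.pow_le_pow_right (by omega) hj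
    rcases hcase with h | h | h
    · exact h.2
    · exact (hmono 7 (by norm_num)).trans h.2.2
    · exact (hmono 8 (by norm_num)).trans h.2
  by_contra! hlt
  have hpow := pow_length_digits_le_of_eq_add_reverse hb hNpos hARH
  have hsum := sum_digits_le_pred_mul_length hb N
  rw [← hk] at hpow hsum
  have hMlt : M < b ^ (Nat.log b M + 1) := Nat.lt_pow_succ_log_self hb M
  obtain ⟨n, hn⟩ : ∃ n, k = Nat.log b M + 3 + n := Nat.exists_eq_add_of_le (by omega)
  have hkn : (b - 1) * k ≤ b ^ n :=
    (Nat.mul_le_mul_left _ (by omega : k ≤ 2 * n + 5)).trans (pred_mul_le_pow hb (by omega))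
  refine absurd hpow (not_le.2 ?_)
  have hb0 : 0 < b := by omega
  calc b ^ 2 * (M * (Nat.digits b N).sum)
      ≤ b ^ 2 * (M * b ^ n) := by gcongr; exact hsum.trans hkn
    _ < b ^ 2 * (b ^ (Nat.log b M + 1) * b ^ n) := by gcongr
    _ = b ^ (Nat.log b M + 3 + n) := by ring
    _ = b ^ k := by rw [← hn]
end

section
/- Let b ≥ 2 be a base and let N be a positive integer with k base-b digits that is a b-MRH number with multiplicative multiplier M, i.e., N = M·s_b(N)·(M·s_b(N))^R. If either (b ≥ 9 and M ≥ b^9), or (5 ≤ b ≤ 8 and M ≥ b^10), or (b = 4 and M ≥ b^11), or (b = 3 and M ≥ b^12), or (b = 2 and M ≥ b^16), then k ≤ 3·⌊log_b M⌋. -/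
/-- An exponential bound that propagates upwards from its first instance. -/
theorem six_mul_add_le_pow {b a : ℕ} (hb : 2 ≤ b) (ha : 6 * a + 16 ≤ b ^ a) {g : ℕ}
    (hg : a ≤ g) : 6 * g + 16 ≤ b ^ g := by
  induction g, hg using Nat.le_induction with
  | base => exact ha
  | succ n _ ih =>
    rw [pow_succ]
    nlinarith [Nat.mul_le_mul_left (b ^ n) hb]

/-- The digit sum is at most `b` times the number of digits. -/
theorem sum_digits_le_length_mul {b : ℕ} (hb : 2 ≤ b) (n : ℕ) :
    (Nat.digits b n).sum ≤ (Nat.digits b n).length * b := by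
  have h := List.sum_le_card_nsmul (Nat.digits b n) b
    fun x hx => (Nat.digits_lt_base (by omega) hx).le
  simpa using h

/-- The product of a number and its base-`b` reversal has at most twice as many digits. -/
theorem length_digits_mul_reverse_le {b : ℕ} (hb : 2 ≤ b) (n : ℕ) :
    (Nat.digits b (n * Nat.ofDigits b (Nat.digits b n).reverse)).length ≤
      2 * (Nat.digits b n).length := by
  rw [Nat.digits_length_le_iff (by omega), two_mul, pow_add]
  have hrev := Nat.ofDigits_lt_base_pow_length (b := b) (l := (Nat.digits b n).reverse)
    (by omega) (fun x hx => Nat.digits_lt_base (by omega) (List.mem_reverse.1 hx))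
  rw [List.length_reverse] at hrev
  exact Nat.mul_lt_mul'' (Nat.lt_base_pow_length_digits (by omega)) hrev

/-- Let `b ≥ 2` and let `N` be a positive integer with `k` base-`b` digits that
is a `b`-MRH number with multiplicative multiplier `M`. If either `b ≥ 9` and
`M ≥ b ^ 9`, or `5 ≤ b ≤ 8` and `M ≥ b ^ 10`, or `b = 4` and `M ≥ b ^ 11`, or
`b = 3` and `M ≥ b ^ 12`, or `b = 2` and `M ≥ b ^ 16`, then
`k ≤ 3 * ⌊log_b M⌋`. -/
theorem stmt_19 (b N M k : ℕ) (hb : 2 ≤ b) (hNpos : 0 < N)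
    (hk : k = (Nat.digits b N).length) (hM : 0 < M)
    (hMRH : N = M * (Nat.digits b N).sum *
      Nat.ofDigits b (Nat.digits b (M * (Nat.digits b N).sum)).reverse)
    (hcase : (9 ≤ b ∧ b ^ 9 ≤ M) ∨ (5 ≤ b ∧ b ≤ 8 ∧ b ^ 10 ≤ M) ∨
      (b = 4 ∧ b ^ 11 ≤ M) ∨ (b = 3 ∧ b ^ 12 ≤ M) ∨ (b = 2 ∧ b ^ 16 ≤ M)) :
    k ≤ 3 * Nat.log b M := by
  by_contra! hlt
  set s := (Nat.digits b N).sum with hs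
  set d := (Nat.digits b (M * s)).length with hd
  set m := Nat.log b M with hm
  have hkd : k ≤ 2 * d := by
    rw [hk, hMRH]
    exact length_digits_mul_reverse_le hb (M * s)
  have hsk : s ≤ k * b := hk ▸ sum_digits_le_length_mul hb N
  have hMm : M < b ^ (m + 1) := Nat.lt_pow_succ_log_self (by omega) M
  have hP : M * s ≠ 0 := by
    intro h
    rw [h, zero_mul] at hMRH
    omega
  have hdP : b ^ d ≤ b * (M * s) := Nat.base_pow_length_digits_le b (M * s) (by omega) hP
  have hlog {e : ℕ} (he : b ^ e ≤ M) : e ≤ m := Nat.le_log_of_pow_le (by omega) he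
  have hpow : 6 * (d - m - 3) + 16 ≤ b ^ (d - m - 3) := by
    rcases hcase with ⟨h, he⟩ | ⟨h, -, he⟩ | ⟨h, he⟩ | ⟨h, he⟩ | ⟨h, he⟩ <;>
      have hme := hlog he
    · exact six_mul_add_le_pow hb
        (le_trans (by norm_num) (Nat.pow_le_pow_left h 2)) (show 2 ≤ _ by omega)
    · exact six_mul_add_le_pow hb
        (le_trans (by norm_num) (Nat.pow_le_pow_left h 3)) (show 3 ≤ _ by omega)
    · exact six_mul_add_le_pow hb (a := 3) (by rw [h]; norm_num) (by omega)
    · exact six_mul_add_le_pow hb (a := 4) (by rw [h]; norm_num) (by omega)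
    · exact six_mul_add_le_pow hb (a := 6) (by rw [h]; norm_num) (by omega)
  have hm9 : 9 ≤ m := by
    rcases hcase with ⟨-, he⟩ | ⟨-, -, he⟩ | ⟨-, he⟩ | ⟨-, he⟩ | ⟨-, he⟩ <;>
      have hme := hlog he <;> omega
  have hkg : k ≤ b ^ (d - m - 3) := by omega
  have hs0 : 0 < s := Nat.pos_of_ne_zero (right_ne_zero_of_mul hP)
  have hsplit : b ^ d = b * (b ^ (m + 1) * (b ^ (d - m - 3) * b)) := by
    conv_lhs => rw [show d = (m + 1) + (d - m - 3) + 1 + 1 by omega]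
    ring
  have hupper : M * s < b ^ (m + 1) * (b ^ (d - m - 3) * b) :=
    Nat.mul_lt_mul_of_lt_of_le hMm (hsk.trans (Nat.mul_le_mul_right b hkg)) (by positivity)
  rw [hsplit] at hdP
  exact absurd (Nat.le_of_mul_le_mul_left hdP (by omega)) (not_le.2 hupper)
end
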